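/- For any matching instance I, there exists an offering order σ on I such that spe(I,σ)=qopt(I), i.e., the SPE matching of the sequential matching game (I,σ) is the Q-optimal (worker-optimal) stable matching of I. -/

import Mathlib

namespace SeqMatching

/-- A matching instance `I = (P, Q, E, ≻)`: firms `P`, workers `Q`, a finite set `E`
of acceptable pairs, and strict preferences encoded by rank functions
(lower rank = more preferred), injective on acceptable partners.
For a firm `p`, `q ≻_p q'` means `rankP p q < rankP p q'`; symmetrically for workers. -/
structure MI (P Q : Type) where
  E : Finset (P × Q)
  rankP : P → Q → ℕ
  rankQ : Q → P → ℕ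
  injP : ∀ p q q', (p, q) ∈ E → (p, q') ∈ E → rankP p q = rankP p q' → q = q'
  injQ : ∀ q p p', (p, q) ∈ E → (p', q) ∈ E → rankQ q p = rankQ q p' → p = p'

namespace MI

variable {P Q : Type}

/-- `μ` is a matching in `I`: a subset of `E` in which every firm and every worker
occurs in at most one pair. -/
def IsMatching (I : MI P Q) (μ : Finset (P × Q)) : Prop :=
  μ ⊆ I.E ∧ ∀ e ∈ μ, ∀ f ∈ μ, (e.1 = f.1 ∨ e.2 = f.2) → e = f

/-- `μ(q) ⪰_q p`: worker `q` is matched in `μ` to `p` or to a firm she strictly prefers to `p`. -/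
def WAtLeast (I : MI P Q) (μ : Finset (P × Q)) (q : Q) (p : P) : Prop :=
  ∃ p', (p', q) ∈ μ ∧ (p' = p ∨ I.rankQ q p' < I.rankQ q p)

/-- `p ≻_q μ(q)`: worker `q` is unmatched in `μ` or matched to a firm strictly less preferred than `p`. -/
def WBelow (I : MI P Q) (μ : Finset (P × Q)) (q : Q) (p : P) : Prop :=
  ∀ p', (p', q) ∈ μ → I.rankQ q p < I.rankQ q p'

/-- `q ≻_p μ(p)`: firm `p` is unmatched in `μ` or matched to a worker strictly less preferred than `q`. -/
def FBelow (I : MI P Q) (μ : Finset (P × Q)) (p : P) (q : Q) : Prop :=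
  ∀ q', (p, q') ∈ μ → I.rankP p q < I.rankP p q'

/-- the acceptable pair `e = (p, q)` blocks `μ`. -/
def Blocks (I : MI P Q) (μ : Finset (P × Q)) (e : P × Q) : Prop :=
  e ∈ I.E ∧ I.FBelow μ e.1 e.2 ∧ I.WBelow μ e.2 e.1

/-- `μ` is a stable matching in `I`. -/
def IsStable (I : MI P Q) (μ : Finset (P × Q)) : Prop :=
  I.IsMatching μ ∧ ∀ e, ¬ I.Blocks μ e

/-- `μ(q) ⪰_q μ'(q)`: worker `q` weakly prefers `μ` to `μ'`. -/
def WGe (I : MI P Q) (μ μ' : Finset (P × Q)) (q : Q) : Prop :=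
  ∀ p', (p', q) ∈ μ' → I.WAtLeast μ q p'

/-- `μ` is the Q-optimal (worker-optimal) stable matching of `I`. -/
def IsQOpt (I : MI P Q) (μ : Finset (P × Q)) : Prop :=
  I.IsStable μ ∧ ∀ μ', I.IsStable μ' → ∀ q, I.WGe μ μ' q

open scoped Classical in
/-- the Q-optimal stable matching `qopt(I)` (it exists and is unique by Gale–Shapley). -/
noncomputable def qopt (I : MI P Q) : Finset (P × Q) :=
  if h : ∃ μ, I.IsQOpt μ then h.choose else ∅

/-- `q` is the most preferred worker on `p`'s list. -/
def TopForFirm (I : MI P Q) (p : P) (q : Q) : Prop :=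
  (p, q) ∈ I.E ∧ ∀ q', (p, q') ∈ I.E → I.rankP p q ≤ I.rankP p q'

/-- `p` is the most preferred firm on `q`'s list. -/
def TopForWorker (I : MI P Q) (q : Q) (p : P) : Prop :=
  (p, q) ∈ I.E ∧ ∀ p', (p', q) ∈ I.E → I.rankQ q p ≤ I.rankQ q p'

variable [DecidableEq P] [DecidableEq Q]

/-- a (2,∞)-instance: every firm has at most two acceptable workers. -/
def FirmsDegTwo (I : MI P Q) : Prop :=
  ∀ p : P, (I.E.filter (fun f => f.1 = p)).card ≤ 2

/-- an (∞,2)-instance: every worker has at most two acceptable firms. -/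
def WorkersDegTwo (I : MI P Q) : Prop :=
  ∀ q : Q, (I.E.filter (fun f => f.2 = q)).card ≤ 2

/-- the deletion `I ∖ e`. -/
def del (I : MI P Q) (e : P × Q) : MI P Q where
  E := I.E.erase e
  rankP := I.rankP
  rankQ := I.rankQ
  injP := fun p q q' h h' hr =>
    I.injP p q q' (Finset.mem_of_mem_erase h) (Finset.mem_of_mem_erase h') hr
  injQ := fun q p p' h h' hr =>
    I.injQ q p p' (Finset.mem_of_mem_erase h) (Finset.mem_of_mem_erase h') hr

/-- the contraction `I / e`: all pairs containing the firm or the worker of `e` are removed. -/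
def contr (I : MI P Q) (e : P × Q) : MI P Q where
  E := I.E.filter (fun f => f.1 ≠ e.1 ∧ f.2 ≠ e.2)
  rankP := I.rankP
  rankQ := I.rankQ
  injP := fun p q q' h h' hr =>
    I.injP p q q' (Finset.filter_subset _ _ h) (Finset.filter_subset _ _ h') hr
  injQ := fun q p p' h h' hr =>
    I.injQ q p p' (Finset.filter_subset _ _ h) (Finset.filter_subset _ _ h') hr

/-- `σ` is an offering order on `I`: an enumeration of `E` without repetition, consistent
with the firms' preferences (if `e ≻_p f` for two offers of the same firm, `e` comes first). -/
def IsOfferOrder (I : MI P Q) (σ : List (P × Q)) : Prop :=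
  σ.Nodup ∧ (∀ e, e ∈ σ ↔ e ∈ I.E) ∧
    ∀ e f, e ∈ σ → f ∈ σ → e.1 = f.1 → I.rankP e.1 e.2 < I.rankP f.1 f.2 →
      σ.idxOf e < σ.idxOf f

/-- restriction `σ / e` of the order `σ` to the pairs of `I / e`. -/
def contrO (σ : List (P × Q)) (e : P × Q) : List (P × Q) :=
  σ.filter (fun f => decide (f.1 ≠ e.1 ∧ f.2 ≠ e.2))

theorem qopt_subset (I : MI P Q) : I.qopt ⊆ I.E := by
  unfold qopt
  split
  · next h => exact h.choose_spec.1.1.1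
  · exact Finset.empty_subset _

/-- the sequentially fixing deferred acceptance algorithm: repeatedly fix the pair of
`qopt` of the current instance that comes first in the offering order. -/
noncomputable def sfda (I : MI P Q) (σ : List (P × Q)) : Finset (P × Q) :=
  match h : σ.find? (fun f => decide (f ∈ I.qopt)) with
  | none => ∅
  | some e => insert e ((I.contr e).sfda (contrO σ e))
termination_by σ.length
decreasing_by
  have he : e ∈ σ := List.mem_of_find?_eq_some h
  have hfail : ¬ (fun f => decide (f.1 ≠ e.1 ∧ f.2 ≠ e.2)) e = true := by simp
  exact List.length_filter_lt_length_iff_exists.mpr ⟨e, he, hfail⟩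

open scoped Classical in
/-- the SPE matching `spe(I, σ)` of the sequential matching game `(I, σ)`. -/
noncomputable def spe (I : MI P Q) (σ : List (P × Q)) : Finset (P × Q) :=
  match σ with
  | [] => ∅
  | e :: rest =>
    if I.WBelow ((I.del e).spe rest) e.2 e.1
    then insert e ((I.contr e).spe (contrO rest e))
    else (I.del e).spe rest
termination_by σ.length
decreasing_by
  all_goals simp only [contrO, List.length_cons]
  all_goals first
    | omega
    | exact Nat.lt_succ_of_le (List.length_filter_le _ _)


theorem spe_nil (I : MI P Q) : I.spe [] = ∅ := by
  unfold spe; rfl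

theorem spe_acc (I : MI P Q) (e : P × Q) (τ : List (P × Q))
    (h : I.WBelow ((I.del e).spe τ) e.2 e.1) :
    I.spe (e :: τ) = insert e ((I.contr e).spe (contrO τ e)) := by
  rw [spe, if_pos h]

theorem spe_rej (I : MI P Q) (e : P × Q) (τ : List (P × Q))
    (h : ¬ I.WBelow ((I.del e).spe τ) e.2 e.1) :
    I.spe (e :: τ) = (I.del e).spe τ := by
  rw [spe, if_neg h]

theorem spe_ind {motive : MI P Q → List (P × Q) → Prop}
    (nil : ∀ I, motive I [])
    (cons : ∀ I e τ, motive (I.del e) τ → motive (I.contr e) (contrO τ e) → motive I (e :: τ)) :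
    ∀ (σ : List (P × Q)) (I : MI P Q), motive I σ := by
  have key : ∀ n : ℕ, ∀ (σ : List (P × Q)), σ.length ≤ n → ∀ I : MI P Q, motive I σ := by
    intro n
    induction n with
    | zero =>
      intro σ hσ I
      have : σ = [] := List.length_eq_zero_iff.mp (by omega)
      subst this; exact nil I
    | succ n ih =>
      intro σ hσ I
      cases σ with
      | nil => exact nil I
      | cons e τ =>
        simp only [List.length_cons] at hσ
        refine cons I e τ (ih τ (by omega) _) (ih _ ?_ _)
        have := List.length_filter_le (fun f : P × Q => decide (f.1 ≠ e.1 ∧ f.2 ≠ e.2)) τ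
        unfold contrO
        omega
  intro σ I
  exact key σ.length σ le_rfl I

theorem mem_contrO {τ : List (P × Q)} {e f : P × Q} :
    f ∈ contrO τ e ↔ f ∈ τ ∧ f.1 ≠ e.1 ∧ f.2 ≠ e.2 := by
  unfold contrO
  rw [List.mem_filter, decide_eq_true_iff]

theorem spe_subset (σ : List (P × Q)) (I : MI P Q) : ∀ f ∈ I.spe σ, f ∈ σ := by
  revert I
  refine spe_ind (motive := fun I σ => ∀ f ∈ I.spe σ, f ∈ σ) ?_ ?_ σ
  · intro I f hf; simp [spe_nil] at hf
  · intro I e τ h1 h2 f hf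
    by_cases h : I.WBelow ((I.del e).spe τ) e.2 e.1
    · rw [spe_acc I e τ h, Finset.mem_insert] at hf
      rcases hf with rfl | hf
      · simp
      · exact List.mem_cons_of_mem _ (mem_contrO.mp (h2 f hf)).1
    · rw [spe_rej I e τ h] at hf
      exact List.mem_cons_of_mem _ (h1 f hf)

theorem spe_matching (σ : List (P × Q)) (I : MI P Q) :
    ∀ e ∈ I.spe σ, ∀ f ∈ I.spe σ, (e.1 = f.1 ∨ e.2 = f.2) → e = f := by
  revert I
  refine spe_ind (motive := fun I σ =>
    ∀ e ∈ I.spe σ, ∀ f ∈ I.spe σ, (e.1 = f.1 ∨ e.2 = f.2) → e = f) ?_ ?_ σ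
  · intro I f hf; simp [spe_nil] at hf
  · intro I e τ h1 h2 a ha b hb hab
    by_cases h : I.WBelow ((I.del e).spe τ) e.2 e.1
    · rw [spe_acc I e τ h, Finset.mem_insert] at ha hb
      rcases ha with rfl | ha <;> rcases hb with rfl | hb
      · rfl
      · have := (mem_contrO.mp (spe_subset _ _ b hb)).2
        exfalso; rcases hab with hab | hab
        · exact this.1 hab.symm
        · exact this.2 hab.symm
      · have := (mem_contrO.mp (spe_subset _ _ a ha)).2
        exfalso; rcases hab with hab | hab
        · exact this.1 hab
        · exact this.2 hab
      · exact h2 a ha b hb hab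
    · rw [spe_rej I e τ h] at ha hb
      exact h1 a ha b hb hab

/-- Lemma B: an offer that is not realised although both sides were free was rejected
for something at least as good. -/
theorem spe_noblock {κ : Type} [LinearOrder κ] (k : P × Q → κ) (f : P × Q)
    (σ : List (P × Q)) (I : MI P Q) (hs : σ.Pairwise (fun a b => k a ≤ k b)) (hf : f ∈ σ)
    (hfn : f ∉ I.spe σ)
    (hlate : ∀ g ∈ I.spe σ, (g.1 = f.1 ∨ g.2 = f.2) → k f < k g) :
    ¬ I.WBelow (I.spe σ) f.2 f.1 := by
  revert I
  have := spe_ind (motive := fun I σ => σ.Pairwise (fun a b => k a ≤ k b) → f ∈ σ →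
    f ∉ I.spe σ → (∀ g ∈ I.spe σ, (g.1 = f.1 ∨ g.2 = f.2) → k f < k g) →
    ¬ I.WBelow (I.spe σ) f.2 f.1) ?_ ?_ σ
  · intro I hfn hl; exact this I hs hf hfn hl
  · intro I _ hf; simp at hf
  · intro I e τ h1 h2 hs hf hfn hl
    rw [List.pairwise_cons] at hs
    by_cases h : I.WBelow ((I.del e).spe τ) e.2 e.1
    · rw [spe_acc I e τ h] at hfn hl ⊢
      rw [Finset.mem_insert, not_or] at hfn
      have hfτ : f ∈ τ := by
        rcases List.mem_cons.mp hf with h' | h'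
        · exact absurd h' hfn.1
        · exact h'
      have hef : ¬ (e.1 = f.1 ∨ e.2 = f.2) := fun h' =>
        absurd (hl e (Finset.mem_insert_self _ _) h') (not_lt.mpr (hs.1 f hfτ))
      rw [not_or] at hef
      intro hw
      refine h2 (hs.2.sublist List.filter_sublist)
        (mem_contrO.mpr ⟨hfτ, Ne.symm hef.1, Ne.symm hef.2⟩) hfn.2
        (fun g hg => hl g (Finset.mem_insert_of_mem hg)) ?_
      intro p' hp'
      exact hw p' (Finset.mem_insert_of_mem hp')
    · rw [spe_rej I e τ h] at hfn hl ⊢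
      rcases List.mem_cons.mp hf with h' | h'
      · subst h'; exact h
      · have hres := h1 hs.2 h' hfn hl
        exact hres

/-- Claim 1: if every `ν`-offer is the top remaining offer of its firm, then every worker of `ν`
is at least as well off in the SPE. -/
theorem spe_ge (ν : Finset (P × Q))
    (hν : ∀ e ∈ ν, ∀ f ∈ ν, (e.1 = f.1 ∨ e.2 = f.2) → e = f)
    (I₀ : MI P Q) (σ : List (P × Q)) (I : MI P Q) (hI : I.rankQ = I₀.rankQ)
    (hE : ∀ e ∈ σ, e ∈ I₀.E)
    (hs : σ.Pairwise (fun a b => a.1 = b.1 → b ∈ ν → a ∈ ν)) :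
    ∀ e ∈ σ, e ∈ ν → I.WAtLeast (I.spe σ) e.2 e.1 := by
  revert I
  have := spe_ind (motive := fun I σ => I.rankQ = I₀.rankQ → (∀ e ∈ σ, e ∈ I₀.E) →
    σ.Pairwise (fun a b => a.1 = b.1 → b ∈ ν → a ∈ ν) →
    ∀ e ∈ σ, e ∈ ν → I.WAtLeast (I.spe σ) e.2 e.1) ?_ ?_ σ
  · intro I hI; exact this I hI hE hs
  · intro I _ _ _ e he; simp at he
  · intro I g τ h1 h2 hI hE hs e he heν
    have hEτ : ∀ e ∈ τ, e ∈ I₀.E := fun e he => hE e (List.mem_cons_of_mem _ he)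
    rw [List.pairwise_cons] at hs
    by_cases h : I.WBelow ((I.del g).spe τ) g.2 g.1
    · rw [spe_acc I g τ h]
      by_cases heg : e = g
      · subst heg
        exact ⟨e.1, Finset.mem_insert_self _ _, Or.inl rfl⟩
      · have heτ : e ∈ τ := by
          rcases List.mem_cons.mp he with h' | h'
          · exact absurd h' heg
          · exact h'
        by_cases h2' : e.2 = g.2
        · obtain ⟨p', hp', hr⟩ := h1 hI hEτ hs.2 e heτ heν
          rw [h2'] at hp' hr
          have hlt := h p' hp'
          refine ⟨g.1, by rw [h2']; exact Finset.mem_insert_self _ _, Or.inr ?_⟩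
          rw [h2']
          rcases hr with rfl | hr
          · exact hlt
          · exact lt_trans hlt hr
        · by_cases h1' : e.1 = g.1
          · exact absurd (hν e heν g (hs.1 e heτ h1'.symm heν) (Or.inl h1')) heg
          · obtain ⟨p', hp', hr⟩ := h2 hI (fun e he => hEτ e (mem_contrO.mp he).1)
              (hs.2.sublist List.filter_sublist) e
              (mem_contrO.mpr ⟨heτ, h1', h2'⟩) heν
            exact ⟨p', Finset.mem_insert_of_mem hp', hr⟩
    · rw [spe_rej I g τ h]
      rcases List.mem_cons.mp he with h' | h'
      · subst h'
        unfold WBelow at h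
        push Not at h
        obtain ⟨p', hp', hr⟩ := h
        by_cases hpe : p' = e.1
        · exact ⟨p', hp', Or.inl hpe⟩
        · by_cases hlt : I.rankQ e.2 p' < I.rankQ e.2 e.1
          · exact ⟨p', hp', Or.inr hlt⟩
          · exfalso
            apply hpe
            refine I₀.injQ e.2 p' e.1 (hEτ _ (spe_subset _ _ _ hp')) (hE e he) ?_
            rw [hI] at hlt hr
            omega
      · exact h1 hI hEτ hs.2 e h' heν

theorem spe_append (B : List (P × Q)) (ν : Finset (P × Q)) (rq : Q → P → ℕ)
    (hB : ∀ J : MI P Q, J.rankQ = rq → J.spe B = ν) (A : List (P × Q))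
    (hA : ∀ e ∈ A, ∃ p', (p', e.2) ∈ ν ∧ rq e.2 p' < rq e.2 e.1) (I : MI P Q)
    (hI : I.rankQ = rq) : I.spe (A ++ B) = ν := by
  induction A generalizing I with
  | nil => exact hB I hI
  | cons e A ih =>
    have h1 : (I.del e).spe (A ++ B) = ν := ih (fun f hf => hA f (List.mem_cons_of_mem _ hf)) _ hI
    rw [List.cons_append, spe_rej, h1]
    rw [h1]
    intro hw
    obtain ⟨p', hp', hlt⟩ := hA e List.mem_cons_self
    have := hw p' hp'
    rw [hI] at this
    omega

/-- A firm order: every firm's best willing worker below its `ν`-partner is either unmatched in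
`ν` or matched in `ν` to a later firm. -/
def FirmOrd (I : MI P Q) (ν : Finset (P × Q)) (t : P → ℕ) : Prop :=
  ∀ p q, (p, q) ∈ I.E → I.WBelow ν q p →
    (∀ q', (p, q') ∈ I.E → I.WBelow ν q' p → I.rankP p q ≤ I.rankP p q') →
    ∀ m, (m, q) ∈ ν → t p < t m

theorem exists_top (I : MI P Q) (p : P) (q : Q) (h : (p, q) ∈ I.E) :
    ∃ p', I.TopForWorker q p' := by
  obtain ⟨f, hf, hmin⟩ := Finset.exists_min_image (I.E.filter (fun f => f.2 = q))
    (fun f => I.rankQ q f.1) ⟨(p, q), by simp [h]⟩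
  rw [Finset.mem_filter] at hf
  obtain ⟨a, b⟩ := f
  obtain ⟨hf, rfl⟩ := hf
  exact ⟨a, hf, fun p' hp' => hmin (p', b) (by simp [hp'])⟩

open scoped Classical in
/-- Gale–Shapley, together with a firm order obtained from the rejection history. -/
theorem gale_shapley (n : ℕ) : ∀ I : MI P Q, I.E.card = n →
    ∃ (ν : Finset (P × Q)) (t : P → ℕ), I.IsQOpt ν ∧ I.FirmOrd ν t := by
  induction n with
  | zero =>
    intro I hI
    have hE : I.E = ∅ := Finset.card_eq_zero.mp hI
    refine ⟨∅, fun _ => 0, ⟨⟨⟨Finset.empty_subset _, ?_⟩, ?_⟩, ?_⟩, ?_⟩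
    · intro e he; simp at he
    · intro e he; have := he.1; simp [hE] at this
    · intro μ' hμ q p' hp'
      have := hμ.1.1 hp'
      simp [hE] at this
    · intro p q h; simp [hE] at h
  | succ n ih =>
    intro I hI
    by_cases hc : ∃ p q q', I.TopForWorker q p ∧ I.TopForWorker q' p ∧ I.rankP p q < I.rankP p q'
    · obtain ⟨p, q, q', hq, hq', hlt⟩ := hc
      have hqq : q ≠ q' := by rintro rfl; exact lt_irrefl _ hlt
      obtain ⟨ν, t, hopt, hord⟩ := ih (I.del (p, q'))
        (by show (I.E.erase (p, q')).card = n
            rw [Finset.card_erase_of_mem hq'.1]; omega)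
      have hmem : ∀ f, f ∈ (I.del (p, q')).E ↔ f ≠ (p, q') ∧ f ∈ I.E := fun f =>
        Finset.mem_erase
      have hpq : (p, q) ∈ (I.del (p, q')).E := (hmem _).mpr ⟨by simp [hqq], hq.1⟩
      have hνE : ∀ f ∈ ν, f ≠ (p, q') ∧ f ∈ I.E := fun f hf => (hmem f).mp (hopt.1.1.1 hf)
      -- `p` holds someone at least as good as `q`
      have hhold : ∃ r, (p, r) ∈ ν ∧ I.rankP p r ≤ I.rankP p q := by
        have hnb := hopt.1.2 (p, q)
        by_contra hcon
        push Not at hcon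
        by_cases hm : (p, q) ∈ ν
        · exact lt_irrefl _ (hcon q hm)
        · refine hnb ⟨hpq, fun r hr => hcon r hr, ?_⟩
          intro p' hp'
          have hle : I.rankQ q p ≤ I.rankQ q p' := hq.2 p' (hνE _ hp').2
          rcases lt_or_eq_of_le hle with h | h
          · exact h
          · have := I.injQ q p p' hq.1 (hνE _ hp').2 h
            subst this; exact absurd hp' hm
      obtain ⟨r, hr, hrq⟩ := hhold
      have hst : I.IsStable ν := by
        refine ⟨⟨fun f hf => (hνE f hf).2, hopt.1.1.2⟩, ?_⟩
        intro f hf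
        by_cases hfe : f = (p, q')
        · subst hfe
          have := hf.2.1 r hr
          simp only at this
          omega
        · exact hopt.1.2 f ⟨(hmem f).mpr ⟨hfe, hf.1⟩, hf.2⟩
      refine ⟨ν, fun x => if x = p ∧ (p, q) ∈ ν then 0 else t x + 1, ⟨hst, ?_⟩, ?_⟩
      · intro μ' hμ'
        have hnot : (p, q') ∉ μ' := by
          intro hin
          refine hμ'.2 (p, q) ⟨hq.1, ?_, ?_⟩
          · intro r' hr'
            have := hμ'.1.2 _ hin _ hr' (Or.inl rfl)
            obtain rfl : q' = r' := congrArg Prod.snd this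
            exact hlt
          · intro p' hp'
            have hle : I.rankQ q p ≤ I.rankQ q p' := hq.2 p' (hμ'.1.1 hp')
            rcases lt_or_eq_of_le hle with h | h
            · exact h
            · have := I.injQ q p p' hq.1 (hμ'.1.1 hp') h
              subst this
              have := hμ'.1.2 _ hin _ hp' (Or.inl rfl)
              exact absurd (congrArg Prod.snd this).symm hqq
        have hst' : (I.del (p, q')).IsStable μ' := by
          refine ⟨⟨fun f hf => (hmem f).mpr ⟨?_, hμ'.1.1 hf⟩, hμ'.1.2⟩, ?_⟩
          · rintro rfl; exact hnot hf
          · intro f hf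
            exact hμ'.2 f ⟨((hmem f).mp hf.1).2, hf.2⟩
        exact hopt.2 μ' hst'
      · intro a b hab hw hbest m hm
        -- nobody points to `p` if `(p,q) ∈ ν`
        have hmp : ¬ (m = p ∧ (p, q) ∈ ν) := by
          rintro ⟨rfl, hpqν⟩
          have := hst.1.2 _ hpqν _ hm (Or.inl rfl)
          obtain rfl : q = b := congrArg Prod.snd this
          have h1 := hw m hm
          have h2 := hq.2 a hab
          omega
        simp only [if_neg hmp]
        by_cases ha : a = p ∧ (p, q) ∈ ν
        · simp [if_pos ha]
        · simp only [if_neg ha]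
          have habne : (a, b) ≠ (p, q') := by
            intro h
            obtain ⟨rfl, rfl⟩ : a = p ∧ b = q' := by simpa using h
            have hnot : (a, q) ∉ ν := fun h' => ha ⟨rfl, h'⟩
            have : I.rankP a b ≤ I.rankP a q := by
              refine hbest q hq.1 ?_
              intro p' hp'
              have hle : I.rankQ q a ≤ I.rankQ q p' := hq.2 p' (hνE _ hp').2
              rcases lt_or_eq_of_le hle with h | h
              · exact h
              · have := I.injQ q a p' hq.1 (hνE _ hp').2 h
                subst this; exact absurd hp' hnot
            omega
          have := hord a b ((hmem _).mpr ⟨habne, hab⟩) hw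
            (fun b' hb' => hbest b' ((hmem _).mp hb').2) m hm
          omega
    · push Not at hc
      have hmem : ∀ f, f ∈ I.E.filter (fun f => I.TopForWorker f.2 f.1) ↔
          I.TopForWorker f.2 f.1 := by
        intro f
        rw [Finset.mem_filter]
        exact ⟨fun h => h.2, fun h => ⟨h.1, h⟩⟩
      have hno : ∀ p q, (p, q) ∈ I.E →
          ¬ I.WBelow (I.E.filter (fun f => I.TopForWorker f.2 f.1)) q p := by
        intro p q hpq hw
        obtain ⟨p', hp'⟩ := I.exists_top p q hpq
        have h1 := hw p' ((hmem (p', q)).mpr hp')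
        have h2 := hp'.2 p hpq
        omega
      refine ⟨I.E.filter (fun f => I.TopForWorker f.2 f.1), fun _ => 0,
        ⟨⟨⟨Finset.filter_subset _ _, ?_⟩, ?_⟩, ?_⟩, ?_⟩
      · rintro ⟨a, b⟩ he ⟨c, d⟩ hf h
        have he := (hmem _).mp he
        have hf := (hmem _).mp hf
        simp only at he hf h
        rcases h with rfl | rfl
        · have h1 := hc a b d he hf
          have h2 := hc a d b hf he
          rw [I.injP a b d he.1 hf.1 (by omega)]
        · have h1 := he.2 c hf.1
          have h2 := hf.2 a he.1
          rw [I.injQ b a c he.1 hf.1 (by omega)]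
      · rintro ⟨a, b⟩ hb
        exact hno a b hb.1 hb.2.2
      · intro μ' hμ' q p' hp'
        have hE := hμ'.1.1 hp'
        obtain ⟨x, hx⟩ := I.exists_top p' q hE
        refine ⟨x, (hmem (x, q)).mpr hx, ?_⟩
        rcases lt_or_eq_of_le (hx.2 p' hE) with h | h
        · exact Or.inr h
        · exact Or.inl (I.injQ q x p' hx.1 hE h)
      · intro p q hpq hw
        exact absurd hw (hno p q hpq)

/-- The heart of the argument: on the reduced instance the SPE is `ν`. -/
theorem spe_reduced (I : MI P Q) (ν : Finset (P × Q)) (t : P → ℕ) (hst : I.IsStable ν)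
    (hord : I.FirmOrd ν t) (B : List (P × Q))
    (hB : ∀ f, f ∈ B ↔ f ∈ I.E ∧ ¬ I.FBelow ν f.1 f.2)
    (hnd : B.Nodup)
    (hs : B.Pairwise (fun a b => toLex (t a.1, I.rankP a.1 a.2) ≤ toLex (t b.1, I.rankP b.1 b.2)))
    (J : MI P Q) (hJ : J.rankQ = I.rankQ) : J.spe B = ν := by
  classical
  have hνB : ∀ f ∈ ν, f ∈ B := by
    intro f hf
    refine (hB f).mpr ⟨hst.1.1 hf, fun h => ?_⟩
    exact lt_irrefl _ (h f.2 hf)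
  have hBν : ∀ f ∈ B, ∃ q', (f.1, q') ∈ ν ∧ I.rankP f.1 q' ≤ I.rankP f.1 f.2 := by
    intro f hf
    have := ((hB f).mp hf).2
    unfold FBelow at this
    push Not at this
    exact this
  have hμB : ∀ f ∈ J.spe B, f ∈ B := spe_subset B J
  have hμm := spe_matching B J
  have hge : ∀ e ∈ ν, J.WAtLeast (J.spe B) e.2 e.1 := by
    intro e he
    refine spe_ge ν hst.1.2 I B J hJ (fun f hf => ((hB f).mp hf).1) ?_ e (hνB e he) he
    refine hs.imp_of_mem ?_
    intro a b ha hb hle hab hbν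
    obtain ⟨q', hq', hr⟩ := hBν a ha
    have h1 : ((a.1, q') : P × Q) = b := hst.1.2 _ hq' _ hbν (Or.inl hab)
    subst h1
    rw [Prod.Lex.toLex_le_toLex] at hle
    simp only [lt_self_iff_false, true_and, false_or] at hle
    have h2 := I.injP a.1 a.2 q' ((hB a).mp ha).1 (hst.1.1 hq') (by omega)
    have h3 : a = (a.1, q') := by rw [← h2]
    rw [h3]; exact hq'
  have injfst : ∀ S : Finset (P × Q), (∀ e ∈ S, ∀ f ∈ S, (e.1 = f.1 ∨ e.2 = f.2) → e = f) →
      (S.image Prod.fst).card = S.card ∧ (S.image Prod.snd).card = S.card := by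
    intro S hS
    exact ⟨Finset.card_image_of_injOn (fun a ha b hb h => hS a ha b hb (Or.inl h)),
      Finset.card_image_of_injOn (fun a ha b hb h => hS a ha b hb (Or.inr h))⟩
  have c1 := injfst ν hst.1.2
  have c2 := injfst (J.spe B) hμm
  have sub1 : (J.spe B).image Prod.fst ⊆ ν.image Prod.fst := by
    intro p hp
    obtain ⟨f, hf, rfl⟩ := Finset.mem_image.mp hp
    obtain ⟨q', hq', -⟩ := hBν f (hμB f hf)
    exact Finset.mem_image.mpr ⟨_, hq', rfl⟩
  have sub2 : ν.image Prod.snd ⊆ (J.spe B).image Prod.snd := by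
    intro q hq
    obtain ⟨f, hf, rfl⟩ := Finset.mem_image.mp hq
    obtain ⟨p', hp', -⟩ := hge f hf
    exact Finset.mem_image.mpr ⟨_, hp', rfl⟩
  have d1 := Finset.card_le_card sub1
  have d2 := Finset.card_le_card sub2
  have e1 : (J.spe B).image Prod.fst = ν.image Prod.fst :=
    Finset.eq_of_subset_of_card_le sub1 (by omega)
  have e2 : ν.image Prod.snd = (J.spe B).image Prod.snd :=
    Finset.eq_of_subset_of_card_le sub2 (by omega)
  have hsub : ν ⊆ J.spe B := by
    by_contra hcon
    have hne : (ν \ J.spe B).Nonempty := Finset.sdiff_nonempty.mpr hcon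
    obtain ⟨e, he, hmax⟩ := Finset.exists_max_image _ (fun f => t f.1) hne
    obtain ⟨p, q0⟩ := e
    rw [Finset.mem_sdiff] at he
    obtain ⟨q', hq'⟩ : ∃ q', (p, q') ∈ J.spe B := by
      have : p ∈ (J.spe B).image Prod.fst := by
        rw [e1]; exact Finset.mem_image.mpr ⟨_, he.1, rfl⟩
      obtain ⟨⟨a, b⟩, hf, rfl⟩ := Finset.mem_image.mp this
      exact ⟨b, hf⟩
    have hwork : ∀ x q, (x, q) ∈ J.spe B → ∃ m, (m, q) ∈ ν := by
      intro x q hx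
      have : q ∈ ν.image Prod.snd := by
        rw [e2]; exact Finset.mem_image.mpr ⟨_, hx, rfl⟩
      obtain ⟨⟨a, b⟩, hf, rfl⟩ := Finset.mem_image.mp this
      exact ⟨a, hf⟩
    obtain ⟨m', hm'⟩ := hwork p q' hq'
    have hpm : p ≠ m' := by
      rintro rfl
      have := hst.1.2 _ hm' _ he.1 (Or.inl rfl)
      rw [this] at hq'
      exact he.2 hq'
    have hwq' : I.WBelow ν q' p := by
      intro x hx
      have hxm : (x, q') = (m', q') := hst.1.2 _ hx _ hm' (Or.inr rfl)
      obtain rfl : x = m' := congrArg Prod.fst hxm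
      obtain ⟨y, hy, hyr⟩ := hge _ hm'
      have hyp : (y, q') = (p, q') := hμm _ hy _ hq' (Or.inr rfl)
      obtain rfl : y = p := congrArg Prod.fst hyp
      rcases hyr with h | h
      · exact absurd h hpm
      · rw [hJ] at h; exact h
    have hEq' : (p, q') ∈ I.E := ((hB _).mp (hμB _ hq')).1
    obtain ⟨g, hg, hgmin⟩ := Finset.exists_min_image
      (I.E.filter (fun f => f.1 = p ∧ I.WBelow ν f.2 p)) (fun f => I.rankP p f.2)
      ⟨(p, q'), by simp [hEq', hwq']⟩
    obtain ⟨a, q⟩ := g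
    rw [Finset.mem_filter] at hg
    obtain ⟨hpq, h1, hwq⟩ := hg
    simp only at h1 hwq
    subst h1
    have hbest : ∀ q2, (a, q2) ∈ I.E → I.WBelow ν q2 a → I.rankP a q ≤ I.rankP a q2 := by
      intro q2 h2 h3
      exact hgmin (a, q2) (by simp [h2, h3])
    have hlater := hord a q hpq hwq hbest
    have hinμ : ∀ m, (m, q) ∈ ν → (m, q) ∈ J.spe B := by
      intro m hm
      by_contra hnm
      have h4 := hmax (m, q) (Finset.mem_sdiff.mpr ⟨hm, hnm⟩)
      have h5 := hlater m hm
      simp only at h4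
      omega
    have hqq : q ≠ q' := by
      rintro rfl
      have := hμm _ (hinμ m' hm') _ hq' (Or.inr rfl)
      exact hpm (congrArg Prod.fst this).symm
    have hrlt : I.rankP a q < I.rankP a q' := by
      rcases lt_or_eq_of_le (hbest q' hEq' hwq') with h | h
      · exact h
      · exact absurd (I.injP a q q' hpq hEq' h) hqq
    have hqB : (a, q) ∈ B := (hB _).mpr ⟨hpq, fun h => hst.2 (a, q) ⟨hpq, h, hwq⟩⟩
    have hnμ : (a, q) ∉ J.spe B := by
      intro h
      exact hqq (congrArg Prod.snd (hμm _ h _ hq' (Or.inl rfl)))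
    refine spe_noblock (fun f => toLex (t f.1, I.rankP f.1 f.2)) (a, q) B J hs hqB hnμ ?_ ?_
    · rintro ⟨x, y⟩ hxy h
      simp only at h
      rw [Prod.Lex.toLex_lt_toLex]
      simp only
      rcases h with rfl | rfl
      · have := hμm _ hxy _ hq' (Or.inl rfl)
        obtain rfl : y = q' := congrArg Prod.snd this
        exact Or.inr ⟨rfl, hrlt⟩
      · obtain ⟨m, hm⟩ := hwork x y hxy
        have := hμm _ hxy _ (hinμ m hm) (Or.inr rfl)
        obtain rfl : x = m := congrArg Prod.fst this
        exact Or.inl (hlater x hm)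
    · intro x hx
      obtain ⟨m, hm⟩ := hwork x q hx
      have := hμm _ hx _ (hinμ m hm) (Or.inr rfl)
      obtain rfl : x = m := congrArg Prod.fst this
      rw [hJ]
      exact hwq x hm
  exact (Finset.eq_of_subset_of_card_le hsub (by omega)).symm

/-- Sorting a finite set by a key. -/
theorem exists_sorted {κ : Type} [LinearOrder κ] (k : P × Q → κ) (S : Finset (P × Q)) :
    ∃ L : List (P × Q), L.Nodup ∧ (∀ f, f ∈ L ↔ f ∈ S) ∧ L.Pairwise (fun a b => k a ≤ k b) := by
  refine ⟨S.toList.mergeSort (fun a b => decide (k a ≤ k b)), ?_, ?_, ?_⟩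
  · exact (List.mergeSort_perm _ _).nodup_iff.mpr S.nodup_toList
  · intro f; rw [List.mem_mergeSort, Finset.mem_toList]
  · have := List.pairwise_mergeSort (le := fun a b : P × Q => decide (k a ≤ k b))
      (fun a b c h1 h2 => by simp only [decide_eq_true_eq] at *; exact le_trans h1 h2)
      (fun a b => by simpa using le_total (k a) (k b)) S.toList
    simpa using this

theorem idxOf_lt_of_sorted {κ : Type} [LinearOrder κ] (k : P × Q → κ) (L : List (P × Q))
    (hs : L.Pairwise (fun a b => k a ≤ k b)) (e f : P × Q) (he : e ∈ L) (hf : f ∈ L)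
    (hlt : k e < k f) : L.idxOf e < L.idxOf f := by
  by_contra hcon
  rw [not_lt] at hcon
  have h1 := List.idxOf_lt_length_iff.mpr he
  have h2 := List.idxOf_lt_length_iff.mpr hf
  rcases lt_or_eq_of_le hcon with h | h
  · have := List.pairwise_iff_getElem.mp hs _ _ h2 h1 h
    rw [List.getElem_idxOf, List.getElem_idxOf] at this
    exact absurd hlt (not_lt.mpr this)
  · have : f = e := (List.idxOf_inj hf).mp h
    subst this
    exact lt_irrefl _ hlt

/-- for any matching instance `I` there is an offering order `σ` such that
`spe(I, σ)` is the Q-optimal (worker-optimal) stable matching of `I`. -/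
theorem stmt_17 (P Q : Type) [DecidableEq P] [DecidableEq Q] (I : MI P Q) :
    ∃ σ : List (P × Q), I.IsOfferOrder σ ∧ I.IsQOpt (I.spe σ) := by
  classical
  obtain ⟨ν, t, hopt, hord⟩ := gale_shapley _ I rfl
  have hst := hopt.1
  obtain ⟨A, hA1, hA2, hA3⟩ := exists_sorted (fun f => toLex (t f.1, I.rankP f.1 f.2))
    (I.E.filter (fun f => I.FBelow ν f.1 f.2))
  obtain ⟨B, hB1, hB2, hB3⟩ := exists_sorted (fun f => toLex (t f.1, I.rankP f.1 f.2))
    (I.E.filter (fun f => ¬ I.FBelow ν f.1 f.2))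
  simp only [Finset.mem_filter] at hA2 hB2
  refine ⟨A ++ B, ⟨?_, ?_, ?_⟩, ?_⟩
  · rw [List.nodup_append]
    refine ⟨hA1, hB1, ?_⟩
    rintro a ha b hb rfl
    exact ((hB2 a).mp hb).2 ((hA2 a).mp ha).2
  · intro e
    rw [List.mem_append, hA2, hB2]
    tauto
  · intro e f he hf hef hlt
    have hk : toLex (t e.1, I.rankP e.1 e.2) < toLex (t f.1, I.rankP f.1 f.2) := by
      rw [Prod.Lex.toLex_lt_toLex]
      exact Or.inr ⟨by rw [hef], hlt⟩
    by_cases heA : e ∈ A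
    · by_cases hfA : f ∈ A
      · rw [List.idxOf_append_of_mem heA, List.idxOf_append_of_mem hfA]
        exact idxOf_lt_of_sorted _ A hA3 e f heA hfA hk
      · rw [List.idxOf_append_of_mem heA, List.idxOf_append_of_notMem hfA]
        have := List.idxOf_lt_length_iff.mpr heA
        omega
    · have heB : e ∈ B := (List.mem_append.mp he).resolve_left heA
      have hfA : f ∉ A := by
        intro hfA
        refine ((hB2 e).mp heB).2 ?_
        intro q' hq'
        have h1 := ((hA2 f).mp hfA).2 q' (by rw [← hef]; exact hq')
        rw [← hef] at h1
        rw [← hef] at hlt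
        omega
      have hfB : f ∈ B := (List.mem_append.mp hf).resolve_left hfA
      rw [List.idxOf_append_of_notMem heA, List.idxOf_append_of_notMem hfA]
      have := idxOf_lt_of_sorted _ B hB3 e f heB hfB hk
      omega
  · have : I.spe (A ++ B) = ν := by
      refine spe_append B ν I.rankQ
        (fun J hJ => spe_reduced I ν t hst hord B hB2 hB1 hB3 J hJ) A ?_ I rfl
      intro e he
      obtain ⟨heE, hF⟩ := (hA2 e).mp he
      have hnb := hst.2 e
      have hW : ¬ I.WBelow ν e.2 e.1 := fun h => hnb ⟨heE, hF, h⟩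
      unfold WBelow at hW
      push Not at hW
      obtain ⟨p', hp', hr⟩ := hW
      refine ⟨p', hp', lt_of_le_of_ne hr ?_⟩
      intro heq
      obtain rfl := I.injQ e.2 p' e.1 (hst.1.1 hp') heE heq
      exact lt_irrefl _ (hF e.2 hp')
    rw [this]
    exact hopt

end MI

end SeqMatching
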